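/- Let μ = e^{−Φ} L^{2N} × H^N⌞E on Z × Z, where Φ : Z → ℝ is Borel and satisfies the sub-Gaussian transversality condition β₀‖y − z‖² + Φ(y) ≥ c(‖y‖² + ‖z‖²) − b for all y ∈ Z, z ∈ E, with constants β₀, c, b > 0. Then μ is weakly transversal: there exist a sequence β_h → +∞ and a finite nonnegative measure μ_∞ on Z × Z such that each μ_{β_h} is finite and ∫ f dμ_{β_h} → ∫ f dμ_∞ for every bounded continuous function f on Z × Z. -/

import Mathlib

open MeasureTheory Real Filter Topology

noncomputable section

/-- Phase space `Z`, identified with `ℝ^{2N}` (with Lebesgue measure `volume`). -/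
abbrev ZZ (N : ℕ) := EuclideanSpace ℝ (Fin (2 * N))

/-- The normalization constant `B_β = ∫_Z exp(−β‖ξ‖²) dL^{2N}(ξ)`. -/
def Bconst (N : ℕ) (β : ℝ) : ℝ := ∫ ξ : ZZ N, Real.exp (-β * ‖ξ‖ ^ 2)

/-- The thermalization `μ_β := w_β · μ` with `w_β(y,z) = B_β⁻¹ exp(−β‖y−z‖²)`. -/
def therm {N : ℕ} (μ : Measure (ZZ N × ZZ N)) (β : ℝ) : Measure (ZZ N × ZZ N) :=
  μ.withDensity fun q => ENNReal.ofReal ((Bconst N β)⁻¹ * Real.exp (-β * ‖q.1 - q.2‖ ^ 2))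

/-- The deterministic physical likelihood `μ_E = H^N ⌞ E`. -/
def muE (N : ℕ) (E : AffineSubspace ℝ (ZZ N)) : Measure (ZZ N) :=
  (μH[(N : ℝ)]).restrict (E : Set (ZZ N))

/-- The sub-Gaussian material likelihood `μ_D = e^{−Φ} L^{2N}`. -/
def muD (N : ℕ) (Φ : ZZ N → ℝ) : Measure (ZZ N) :=
  volume.withDensity fun y => ENNReal.ofReal (Real.exp (-Φ y))

/-!
STATEMENT 4: For `μ = e^{−Φ} L^{2N} × H^N⌞E` with `Φ` Borel satisfying the sub-Gaussian
transversality condition, `μ` is weakly transversal: there exist a sequence `β_h → +∞`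
and a finite nonnegative measure `μ_∞` on `Z × Z` such that each `μ_{β_h}` is finite and
`∫ f dμ_{β_h} → ∫ f dμ_∞` for every bounded continuous `f`.
-/

open scoped NNReal ENNReal

/-- A tight sequence of finite measures of bounded mass has a narrowly convergent subsequence. -/
theorem MeasureTheory.FiniteMeasure.exists_subseq_tendsto_of_isTightMeasureSet {X : Type*}
    [Nonempty X] [TopologicalSpace X] [TopologicalSpace.MetrizableSpace X]
    [TopologicalSpace.SeparableSpace X] [MeasurableSpace X] [BorelSpace X]
    (μ : ℕ → FiniteMeasure X) (C : ℝ≥0) (hC : ∀ n, (μ n).mass ≤ C)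
    (ht : IsTightMeasureSet (Set.range fun n => (μ n : Measure X))) :
    ∃ (ν : FiniteMeasure X) (φ : ℕ → ℕ), StrictMono φ ∧ Tendsto (μ ∘ φ) atTop (𝓝 ν) := by
  obtain ⟨m, -, φ, hφ, hm⟩ := (isCompact_Icc (a := 0) (b := C)).tendsto_subseq
    (x := fun n => (μ n).mass) fun n => ⟨zero_le, hC n⟩
  obtain rfl | hm0 := eq_or_ne m 0
  · exact ⟨0, φ, hφ, FiniteMeasure.tendsto_zero_of_tendsto_zero_mass hm⟩
  obtain ⟨n₀, hn₀⟩ := eventually_atTop.1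
    (hm.eventually_const_lt (NNReal.half_lt_self hm0))
  let P : ℕ → ProbabilityMeasure X := fun n => (μ (φ (n + n₀))).normalize
  have hmass (n : ℕ) : m / 2 < (μ (φ (n + n₀))).mass := hn₀ _ (Nat.le_add_left _ _)
  have hP : IsTightMeasureSet
      {((p : ProbabilityMeasure X) : Measure X) | p ∈ Set.range P} := by
    rw [isTightMeasureSet_iff_exists_isCompact_measure_compl_le] at ht ⊢
    intro ε hε
    obtain ⟨K, hK, hle⟩ := ht (((m / 2 : ℝ≥0) : ℝ≥0∞) * ε)
      (ENNReal.mul_pos (by simpa using hm0) hε.ne')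
    refine ⟨K, hK, ?_⟩
    rintro _ ⟨_, ⟨n, rfl⟩, rfl⟩
    have hne : (μ (φ (n + n₀))).mass ≠ 0 := (zero_le.trans_lt (hmass n)).ne'
    have hK' := hle _ ⟨φ (n + n₀), rfl⟩
    rw [FiniteMeasure.toMeasure_normalize_eq_of_nonzero _
      ((FiniteMeasure.mass_nonzero_iff _).1 hne), Measure.coe_nnreal_smul_apply,
      ENNReal.coe_inv hne, mul_comm, ← div_eq_mul_inv]
    refine ENNReal.div_le_of_le_mul' (hK'.trans ?_)
    gcongr
    exact (hmass n).le
  obtain ⟨p, -, ψ, hψ, hp⟩ := (isCompact_closure_of_isTightMeasureSet hP).tendsto_subseq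
    (x := P) fun n => subset_closure ⟨n, rfl⟩
  refine ⟨m • p.toFiniteMeasure, fun n => φ (ψ n + n₀),
    hφ.comp fun a b hab => Nat.add_lt_add_right (hψ hab) n₀, ?_⟩
  have hm' : Tendsto (fun n => (μ (φ (ψ n + n₀))).mass) atTop (𝓝 m) :=
    hm.comp (tendsto_atTop_mono (fun n => Nat.le_add_right _ _) hψ.tendsto_atTop)
  have hp' := (ProbabilityMeasure.toFiniteMeasure_continuous.tendsto p).comp hp
  refine (hm'.smul hp').congr fun n => ?_
  exact (FiniteMeasure.self_eq_mass_smul_normalize _).symm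

/-- Uniformly bounded Gaussian moments imply tightness. -/
theorem isTightMeasureSet_of_lintegral_exp_le {V : Type*} [NormedAddCommGroup V]
    [ProperSpace V] [MeasurableSpace V] [BorelSpace V] [SecondCountableTopology V]
    {S : Set (Measure (V × V))} {a : ℝ} (ha : 0 < a) {M : ℝ≥0∞} (hM : M ≠ ∞)
    (hS : ∀ μ ∈ S, ∫⁻ q, ENNReal.ofReal (exp (a * (‖q.1‖ ^ 2 + ‖q.2‖ ^ 2))) ∂μ ≤ M) :
    IsTightMeasureSet S := by
  rw [isTightMeasureSet_iff_exists_isCompact_measure_compl_le]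
  intro ε hε
  have hlim : Tendsto (fun R : ℝ => M / ENNReal.ofReal (exp (a * R ^ 2))) atTop (𝓝 0) := by
    rw [← ENNReal.div_top (a := M)]
    refine ENNReal.Tendsto.const_div (ENNReal.tendsto_ofReal_atTop.comp
      (tendsto_exp_atTop.comp ?_)) (Or.inr hM)
    exact (tendsto_pow_atTop two_ne_zero).const_mul_atTop ha
  obtain ⟨R, hRε, hR⟩ := ((hlim.eventually_le_const hε).and (eventually_ge_atTop 0)).exists
  refine ⟨Metric.closedBall 0 R, isCompact_closedBall 0 R, fun μ hμ => ?_⟩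
  calc
    μ (Metric.closedBall 0 R)ᶜ ≤ μ {q | ENNReal.ofReal (exp (a * R ^ 2)) ≤
        ENNReal.ofReal (exp (a * (‖q.1‖ ^ 2 + ‖q.2‖ ^ 2)))} := by
      refine measure_mono fun q hq => ENNReal.ofReal_le_ofReal ?_
      rw [exp_le_exp]
      refine mul_le_mul_of_nonneg_left ?_ ha.le
      simp only [Set.mem_compl_iff, mem_closedBall_zero_iff, Prod.norm_def, not_le,
        lt_max_iff] at hq
      rcases hq with h | h
      · nlinarith [sq_nonneg ‖q.2‖]
      · nlinarith [sq_nonneg ‖q.1‖]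
    _ ≤ (∫⁻ q, ENNReal.ofReal (exp (a * (‖q.1‖ ^ 2 + ‖q.2‖ ^ 2))) ∂μ) /
        ENNReal.ofReal (exp (a * R ^ 2)) :=
      meas_ge_le_lintegral_div (by fun_prop) (by simp [exp_pos]) ENNReal.ofReal_ne_top
    _ ≤ M / ENNReal.ofReal (exp (a * R ^ 2)) := by
      gcongr
      exact hS μ hμ
    _ ≤ ε := hRε

theorem integrable_exp_neg_mul_sq_norm {V : Type*} [NormedAddCommGroup V]
    [InnerProductSpace ℝ V] [FiniteDimensional ℝ V] [MeasurableSpace V] [BorelSpace V]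
    (ν : Measure V) [ν.IsAddHaarMeasure] {a : ℝ} (ha : 0 < a) :
    Integrable (fun v => exp (-a * ‖v‖ ^ 2)) ν := by
  have hvol : Integrable (fun v : V => exp (-a * ‖v‖ ^ 2)) := by
    refine (GaussianFourier.integrable_cexp_neg_mul_sq_norm_add (b := a) (by simpa) 0
      (0 : V)).norm.congr (.of_forall fun v => ?_)
    simp [Complex.norm_exp, ← Complex.ofReal_pow]
  rw [Measure.isAddLeftInvariant_eq_smul ν volume]
  exact hvol.smul_measure ENNReal.coe_ne_top

theorem Bconst_eq (N : ℕ) {β : ℝ} (hβ : 0 < β) : Bconst N β = (π / β) ^ N := by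
  rw [Bconst, GaussianFourier.integral_rexp_neg_mul_sq_norm hβ]
  simp

theorem Bconst_sub_div_le (N : ℕ) {β₀ β : ℝ} (hβ₀ : 0 < β₀) (hβ : 2 * β₀ ≤ β) :
    (Bconst N β)⁻¹ * Bconst N (β - β₀) ≤ 2 ^ N := by
  have h₁ : 0 < β := by linarith
  have h₂ : 0 < β - β₀ := by linarith
  rw [Bconst_eq N h₁, Bconst_eq N h₂, ← inv_pow, ← mul_pow]
  refine pow_le_pow_left₀ (by positivity) ?_ N
  have : (π / β)⁻¹ * (π / (β - β₀)) = β / (β - β₀) := by field_simp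
  rw [this, div_le_iff₀ h₂]
  linarith

theorem muE_eq_map {N : ℕ} {E : AffineSubspace ℝ (ZZ N)}
    (hdim : Module.finrank ℝ E.direction = N) {p : ZZ N} (hp : p ∈ E) :
    muE N E = (μH[Module.finrank ℝ E.direction] : Measure E.direction).map
      fun v : E.direction => (v : ZZ N) + p := by
  have hiso : Isometry fun v : E.direction => (v : ZZ N) + p :=
    (IsometryEquiv.addRight p).isometry.comp isometry_subtype_coe
  rw [hiso.map_hausdorffMeasure (Or.inl (by positivity)), muE, hdim]
  congr 1
  ext z
  constructor
  · exact fun hz => ⟨⟨z - p, AffineSubspace.vsub_mem_direction hz hp⟩, by simp⟩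
  · rintro ⟨v, rfl⟩
    exact AffineSubspace.vadd_mem_of_mem_direction v.2 hp

theorem sFinite_muE {N : ℕ} {E : AffineSubspace ℝ (ZZ N)} (hE : (E : Set (ZZ N)).Nonempty)
    (hdim : Module.finrank ℝ E.direction = N) : SFinite (muE N E) := by
  obtain ⟨p, hp⟩ := hE
  rw [muE_eq_map hdim hp]
  infer_instance

theorem lintegral_exp_neg_mul_sq_norm_muE_lt_top {N : ℕ} {E : AffineSubspace ℝ (ZZ N)}
    (hE : (E : Set (ZZ N)).Nonempty) (hdim : Module.finrank ℝ E.direction = N) {a : ℝ}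
    (ha : 0 < a) : ∫⁻ z, ENNReal.ofReal (exp (-a * ‖z‖ ^ 2)) ∂muE N E < ∞ := by
  obtain ⟨p, hp⟩ := hE
  rw [muE_eq_map hdim hp, lintegral_map (by fun_prop) (by fun_prop)]
  refine lt_of_le_of_lt (lintegral_mono fun v => ENNReal.ofReal_le_ofReal ?_)
    ((integrable_exp_neg_mul_sq_norm _ (half_pos ha)).const_mul
      (exp (a * ‖p‖ ^ 2))).lintegral_lt_top
  rw [← exp_add, exp_le_exp]
  have h₁ : ‖v‖ ≤ ‖(v : ZZ N) + p‖ + ‖p‖ := by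
    simpa using norm_sub_le ((v : ZZ N) + p) p
  have h₂ : ‖v‖ ^ 2 ≤ 2 * ‖(v : ZZ N) + p‖ ^ 2 + 2 * ‖p‖ ^ 2 :=
    (pow_le_pow_left₀ (norm_nonneg _) h₁ 2).trans
      (by nlinarith [sq_nonneg (‖(v : ZZ N) + p‖ - ‖p‖)])
  nlinarith

/-- Thermalizations have Gaussian moments controlled by the Gaussian mass of `E`. -/
theorem lintegral_exp_therm_le {N : ℕ} {E : AffineSubspace ℝ (ZZ N)}
    (hE : (E : Set (ZZ N)).Nonempty) (hdim : Module.finrank ℝ E.direction = N)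
    {Φ : ZZ N → ℝ} (hΦ : Measurable Φ) {β₀ c b β : ℝ} (hβ₀ : 0 < β₀) (hβ : 2 * β₀ ≤ β)
    (hc : 0 < c) (htrans : ∀ y : ZZ N, ∀ z ∈ E,
      c * (‖y‖ ^ 2 + ‖z‖ ^ 2) - b ≤ β₀ * ‖y - z‖ ^ 2 + Φ y) :
    ∫⁻ q, ENNReal.ofReal (exp (c / 2 * (‖q.1‖ ^ 2 + ‖q.2‖ ^ 2)))
        ∂therm ((muD N Φ).prod (muE N E)) β ≤
      ENNReal.ofReal (2 ^ N * exp b) *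
        ∫⁻ z, ENNReal.ofReal (exp (-(c / 2) * ‖z‖ ^ 2)) ∂muE N E := by
  have := sFinite_muE hE hdim
  have hB : 0 ≤ (Bconst N β)⁻¹ := by
    rw [Bconst_eq N (by linarith)]
    have : 0 < β := by linarith
    positivity
  have hβ' : 0 < β - β₀ := by linarith
  rw [therm, lintegral_withDensity_eq_lintegral_mul _ (by fun_prop) (by fun_prop), muD,
    prod_withDensity_left (by fun_prop),
    lintegral_withDensity_eq_lintegral_mul _ (by fun_prop) (by fun_prop),
    lintegral_prod_symm _ (by fun_prop), ← lintegral_const_mul _ (by fun_prop)]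
  have hmem : ∀ᵐ z ∂muE N E, z ∈ E :=
    ae_restrict_mem (AffineSubspace.closed_of_finiteDimensional E).measurableSet
  refine lintegral_mono_ae (hmem.mono fun z hz => ?_)
  have hint : Integrable fun y : ZZ N => exp (-(β - β₀) * ‖y - z‖ ^ 2) :=
    (integrable_exp_neg_mul_sq_norm volume hβ').comp_sub_right z
  calc
    _ ≤ ∫⁻ y, ENNReal.ofReal ((Bconst N β)⁻¹ * exp b * exp (-(c / 2) * ‖z‖ ^ 2) *
          exp (-(β - β₀) * ‖y - z‖ ^ 2)) := by
      refine lintegral_mono fun y => ?_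
      simp only [Pi.mul_apply]
      rw [← ENNReal.ofReal_mul (by positivity), ← ENNReal.ofReal_mul (by positivity)]
      refine ENNReal.ofReal_le_ofReal ?_
      have hexp : exp (-Φ y) * exp (-β * ‖y - z‖ ^ 2) * exp (c / 2 * (‖y‖ ^ 2 + ‖z‖ ^ 2)) ≤
          exp b * exp (-(c / 2) * ‖z‖ ^ 2) * exp (-(β - β₀) * ‖y - z‖ ^ 2) := by
        simp only [← exp_add]
        rw [exp_le_exp]
        nlinarith [htrans y z hz, mul_nonneg hc.le (sq_nonneg ‖y‖)]
      linarith [mul_le_mul_of_nonneg_left hexp hB]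
    _ = ENNReal.ofReal ((Bconst N β)⁻¹ * exp b * exp (-(c / 2) * ‖z‖ ^ 2) *
          Bconst N (β - β₀)) := by
      rw [← ofReal_integral_eq_lintegral_ofReal (hint.const_mul _)
        (.of_forall fun y => by positivity), integral_const_mul,
        integral_sub_right_eq_self (fun y : ZZ N => exp (-(β - β₀) * ‖y‖ ^ 2)) z, Bconst, Bconst]
    _ ≤ _ := by
      rw [← ENNReal.ofReal_mul (by positivity)]
      refine ENNReal.ofReal_le_ofReal ?_
      have := mul_le_mul_of_nonneg_right (Bconst_sub_div_le N hβ₀ hβ)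
        (by positivity : 0 ≤ exp b * exp (-(c / 2) * ‖z‖ ^ 2))
      linarith

theorem subGaussian_weakly_transversal
    (N : ℕ) (E : AffineSubspace ℝ (ZZ N)) (hE : (E : Set (ZZ N)).Nonempty)
    (hdim : Module.finrank ℝ E.direction = N)
    (Φ : ZZ N → ℝ) (hΦ : Measurable Φ)
    (β₀ c b : ℝ) (hβ₀ : 0 < β₀) (hc : 0 < c) (hb : 0 < b)
    (htrans : ∀ y : ZZ N, ∀ z ∈ E, c * (‖y‖ ^ 2 + ‖z‖ ^ 2) - b ≤ β₀ * ‖y - z‖ ^ 2 + Φ y) :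
    ∃ (βs : ℕ → ℝ) (μlim : Measure (ZZ N × ZZ N)),
      Tendsto βs atTop atTop ∧
      IsFiniteMeasure μlim ∧
      (∀ h : ℕ, IsFiniteMeasure (therm ((muD N Φ).prod (muE N E)) (βs h))) ∧
      (∀ f : BoundedContinuousFunction (ZZ N × ZZ N) ℝ,
        Tendsto (fun h : ℕ => ∫ q, f q ∂(therm ((muD N Φ).prod (muE N E)) (βs h)))
          atTop (𝓝 (∫ q, f q ∂μlim))) := by
  set μ : ℕ → Measure (ZZ N × ZZ N) := fun h =>
    therm ((muD N Φ).prod (muE N E)) (2 * β₀ + h)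
  set M : ℝ≥0∞ := ENNReal.ofReal (2 ^ N * exp b) *
    ∫⁻ z, ENNReal.ofReal (exp (-(c / 2) * ‖z‖ ^ 2)) ∂muE N E
  have hM : M ≠ ∞ := ENNReal.mul_ne_top ENNReal.ofReal_ne_top
    (lintegral_exp_neg_mul_sq_norm_muE_lt_top hE hdim (half_pos hc)).ne
  have hmom (h : ℕ) :
      ∫⁻ q, ENNReal.ofReal (exp (c / 2 * (‖q.1‖ ^ 2 + ‖q.2‖ ^ 2))) ∂μ h ≤ M :=
    lintegral_exp_therm_le hE hdim hΦ hβ₀ (by simp) hc htrans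
  have hmass (h : ℕ) : μ h Set.univ ≤ M := by
    rw [← lintegral_one]
    refine (lintegral_mono fun q => ?_).trans (hmom h)
    rw [← ENNReal.ofReal_one]
    exact ENNReal.ofReal_le_ofReal (one_le_exp (by positivity))
  have hfin (h : ℕ) : IsFiniteMeasure (μ h) := ⟨(hmass h).trans_lt hM.lt_top⟩
  obtain ⟨ν, φ, hφ, hν⟩ := FiniteMeasure.exists_subseq_tendsto_of_isTightMeasureSet
    (fun h => ⟨μ h, hfin h⟩) M.toNNReal (fun h => ENNReal.toNNReal_mono hM (hmass h))
    (isTightMeasureSet_of_lintegral_exp_le (half_pos hc) hM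
      (by rintro _ ⟨h, rfl⟩; exact hmom h))
  refine ⟨fun h => 2 * β₀ + φ h, ν, ?_, inferInstance, fun h => hfin (φ h), ?_⟩
  · exact tendsto_atTop_add_const_left _ _
      (tendsto_natCast_atTop_atTop.comp hφ.tendsto_atTop)
  · exact FiniteMeasure.tendsto_iff_forall_integral_tendsto.1 hν
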